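/- arXiv:2405.19938 — 2 statements merged into one kernel-verified Lean document; each statement's English description precedes it below -/
import Mathlib

section
/- Let n ≥ 1 and let n₁, n₂ be integers with n₁ ≥ 1, n₂ ≥ 0 and n = n₁ + n₂. Let F_{n₁} be the partial Fourier transformation with respect to the first n₁ variables, (F_{n₁}u)(ξ₁,…,ξ_{n₁}, x_{n₁+1},…,x_n) = ∫_{ℝ^{n₁}} e^{−2πi(x₁ξ₁+⋯+x_{n₁}ξ_{n₁})} u(x₁,…,x_n) dx₁⋯dx_{n₁}. Then μ(F_{n₁}) = n₁/(4π). -/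
open MeasureTheory Matrix

noncomputable section

/-- Partial Fourier transformation in the first `n₁` variables of `ℝⁿ = ℝ^{n₁} × ℝ^{n₂}`. -/
def partialFT {n₁ n₂ : ℕ} (u : (Fin n₁ → ℝ) × (Fin n₂ → ℝ) → ℂ) :
    (Fin n₁ → ℝ) × (Fin n₂ → ℝ) → ℂ :=
  fun p => ∫ x₁ : Fin n₁ → ℝ,
    Complex.exp (-(2 * (Real.pi : ℂ) * Complex.I) * ((x₁ ⬝ᵥ p.1 : ℝ) : ℂ)) * u (x₁, p.2)

/-- The variance `V(f) = ∫ |x|² |f(x)|² dx` on `ℝ^{n₁} × ℝ^{n₂}`. -/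
def variance {n₁ n₂ : ℕ} (f : (Fin n₁ → ℝ) × (Fin n₂ → ℝ) → ℂ) : ℝ :=
  ∫ p : (Fin n₁ → ℝ) × (Fin n₂ → ℝ),
    ((∑ i, (p.1 i) ^ 2) + ∑ j, (p.2 j) ^ 2) * ‖f p‖ ^ 2

/-- `μ(M)`: the infimum of `√(V(Mu)·V(u))` over normalized Schwartz functions `u`. -/
def mu {n₁ n₂ : ℕ}
    (M : ((Fin n₁ → ℝ) × (Fin n₂ → ℝ) → ℂ) → ((Fin n₁ → ℝ) × (Fin n₂ → ℝ) → ℂ)) : ℝ :=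
  sInf { r : ℝ | ∃ u : SchwartzMap ((Fin n₁ → ℝ) × (Fin n₂ → ℝ)) ℂ,
    (∫ p, ‖u p‖ ^ 2) = 1 ∧ r = Real.sqrt (variance (M ⇑u) * variance ⇑u) }

section GaussianSchwartz

variable {E : Type} [NormedAddCommGroup E] [NormedSpace ℝ E]

theorem Function.HasTemperateGrowth.fderiv {F : Type} [NormedAddCommGroup F] [NormedSpace ℝ F]
    {f : E → F} (hf : f.HasTemperateGrowth) :
    (fun x => _root_.fderiv ℝ f x).HasTemperateGrowth := by
  refine ⟨hf.1.fderiv_right (by simp), fun n => ?_⟩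
  obtain ⟨k, C, h⟩ := hf.2 (n + 1)
  exact ⟨k, C, fun x => by simpa [norm_iteratedFDeriv_fderiv] using h x⟩

theorem one_add_pow_mul_exp_neg_sq_le (m : ℕ) {r : ℝ} (hr : 0 ≤ r) :
    (1 + r) ^ m * Real.exp (-r ^ 2) ≤ m.factorial * Real.exp 2 := by
  have h1 := Real.pow_div_factorial_le_exp (1 + r) (by positivity) m
  rw [div_le_iff₀ (by positivity)] at h1
  calc (1 + r) ^ m * Real.exp (-r ^ 2)
      ≤ (Real.exp (1 + r) * m.factorial) * Real.exp (-r ^ 2) := by gcongr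
    _ = m.factorial * Real.exp (1 + r - r ^ 2) := by
        rw [sub_eq_add_neg, Real.exp_add (1 + r)]; ring
    _ ≤ m.factorial * Real.exp 2 := by
        gcongr
        nlinarith [sq_nonneg (r - 1 / 2)]

theorem exists_bound_iteratedFDeriv_exp_neg_smul {Q : E → ℝ} (hQ : Q.HasTemperateGrowth)
    (hle : ∀ x, ‖x‖ ^ 2 ≤ Q x) (k n : ℕ) :
    ∀ {F : Type} [NormedAddCommGroup F] [NormedSpace ℝ F] {f : E → F},
      f.HasTemperateGrowth →
      ∃ C : ℝ, ∀ x, ‖x‖ ^ k * ‖iteratedFDeriv ℝ n (fun x => Real.exp (-Q x) • f x) x‖ ≤ C := by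
  induction n with
  | zero =>
    intro F _ _ f hf
    obtain ⟨l, C, hC, h⟩ := hf.norm_iteratedFDeriv_le_uniform 0
    refine ⟨C * ((k + l).factorial * Real.exp 2), fun x => ?_⟩
    have hfx : ‖f x‖ ≤ C * (1 + ‖x‖) ^ l := by simpa using h 0 le_rfl x
    rw [norm_iteratedFDeriv_zero, norm_smul, Real.norm_of_nonneg (Real.exp_pos _).le]
    calc ‖x‖ ^ k * (Real.exp (-Q x) * ‖f x‖)
        ≤ (1 + ‖x‖) ^ k * (Real.exp (-‖x‖ ^ 2) * (C * (1 + ‖x‖) ^ l)) := by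
          gcongr
          · linarith
          · exact hle x
      _ = C * ((1 + ‖x‖) ^ (k + l) * Real.exp (-‖x‖ ^ 2)) := by ring
      _ ≤ _ := by
          exact mul_le_mul_of_nonneg_left
            (one_add_pow_mul_exp_neg_sq_le _ (norm_nonneg x)) hC
  | succ n ih =>
    intro F _ _ f hf
    have hd : _root_.fderiv ℝ (fun x => Real.exp (-Q x) • f x) = fun x => Real.exp (-Q x) •
        (_root_.fderiv ℝ f x - (_root_.fderiv ℝ Q x).smulRight (f x)) := by
      ext x v
      have h1 : HasFDerivAt Q (_root_.fderiv ℝ Q x) x :=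
        (hQ.1.differentiable (by simp) x).hasFDerivAt
      have h2 : HasFDerivAt f (_root_.fderiv ℝ f x) x :=
        (hf.1.differentiable (by simp) x).hasFDerivAt
      have h3 : HasFDerivAt (fun x => Real.exp (-Q x) • f x) _ x := h1.neg.exp.smul h2
      rw [h3.fderiv]
      simp [mul_smul, sub_eq_add_neg]
    have hg : (fun x => _root_.fderiv ℝ f x -
        (_root_.fderiv ℝ Q x).smulRight (f x)).HasTemperateGrowth := by
      have h3 := (ContinuousLinearMap.smulRightL ℝ E F).bilinear_hasTemperateGrowth hQ.fderiv hf
      exact hf.fderiv.sub h3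
    obtain ⟨C, hC⟩ := ih hg
    refine ⟨C, fun x => ?_⟩
    rw [← norm_iteratedFDeriv_fderiv, hd]
    exact hC x

/-- The function `exp (-Q)`, for `Q` of temperate growth with `‖x‖² ≤ Q x`, as a Schwartz map. -/
def expNegSchwartz (Q : E → ℝ) (hQ : Q.HasTemperateGrowth) (hle : ∀ x, ‖x‖ ^ 2 ≤ Q x) :
    SchwartzMap E ℂ where
  toFun x := Real.exp (-Q x) • (1 : ℂ)
  smooth' := (hQ.1.neg.exp).smul contDiff_const
  decay' k n := exists_bound_iteratedFDeriv_exp_neg_smul hQ hle k n (.const 1)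

theorem expNegSchwartz_apply (Q : E → ℝ) (hQ : Q.HasTemperateGrowth)
    (hle : ∀ x, ‖x‖ ^ 2 ≤ Q x) (x : E) :
    expNegSchwartz Q hQ hle x = Real.exp (-Q x) • (1 : ℂ) := rfl

open scoped LineDeriv in
theorem lineDerivOp_expNegSchwartz (Q : E → ℝ) (hQ : Q.HasTemperateGrowth)
    (hle : ∀ x, ‖x‖ ^ 2 ≤ Q x) (v x : E) :
    (∂_{v} (expNegSchwartz Q hQ hle)) x = -(fderiv ℝ Q x v) • expNegSchwartz Q hQ hle x := by
  have h1 : HasFDerivAt Q (fderiv ℝ Q x) x := (hQ.1.differentiable (by simp) x).hasFDerivAt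
  rw [SchwartzMap.lineDerivOp_apply_eq_fderiv]
  have h2 : HasFDerivAt (expNegSchwartz Q hQ hle) _ x :=
    h1.neg.exp.smul (hasFDerivAt_const (1 : ℂ) x)
  rw [h2.fderiv]
  simp [expNegSchwartz_apply, mul_comm]

end GaussianSchwartz

section PartialParseval

open scoped FourierTransform LineDeriv

variable {n₁ n₂ : ℕ}

theorem hasTemperateGrowth_slice (y : Fin n₂ → ℝ) : Function.HasTemperateGrowth
    (fun x : EuclideanSpace ℝ (Fin n₁) => ((x.ofLp, y) : (Fin n₁ → ℝ) × (Fin n₂ → ℝ))) := by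
  have h := ((ContinuousLinearMap.inl ℝ (Fin n₁ → ℝ) (Fin n₂ → ℝ)).comp
    (EuclideanSpace.equiv (Fin n₁) ℝ).toContinuousLinearMap).hasTemperateGrowth.add
    (Function.HasTemperateGrowth.const ((0, y) : (Fin n₁ → ℝ) × (Fin n₂ → ℝ)))
  convert h using 1
  ext x <;> simp

theorem exists_norm_le_slice (y : Fin n₂ → ℝ) : ∃ (k : ℕ) (C : ℝ),
    ∀ x : EuclideanSpace ℝ (Fin n₁),
      ‖x‖ ≤ C * (1 + ‖((x.ofLp, y) : (Fin n₁ → ℝ) × (Fin n₂ → ℝ))‖) ^ k := by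
  refine ⟨1, ‖((EuclideanSpace.equiv (Fin n₁) ℝ).symm :
    (Fin n₁ → ℝ) →L[ℝ] EuclideanSpace ℝ (Fin n₁))‖, fun x => ?_⟩
  have h := ((EuclideanSpace.equiv (Fin n₁) ℝ).symm :
    (Fin n₁ → ℝ) →L[ℝ] EuclideanSpace ℝ (Fin n₁)).le_opNorm x.ofLp
  refine (le_of_eq (by rfl)).trans (h.trans ?_)
  gcongr
  rw [pow_one]
  have := norm_fst_le ((x.ofLp, y) : (Fin n₁ → ℝ) × (Fin n₂ → ℝ))
  simp only at this
  linarith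

/-- The Schwartz function `x ↦ u (x, y)` on Euclidean space. -/
def schwartzSlice (u : SchwartzMap ((Fin n₁ → ℝ) × (Fin n₂ → ℝ)) ℂ) (y : Fin n₂ → ℝ) :
    SchwartzMap (EuclideanSpace ℝ (Fin n₁)) ℂ :=
  SchwartzMap.compCLM ℝ (hasTemperateGrowth_slice y) (exists_norm_le_slice y) u

theorem schwartzSlice_apply (u : SchwartzMap ((Fin n₁ → ℝ) × (Fin n₂ → ℝ)) ℂ)
    (y : Fin n₂ → ℝ) (x : EuclideanSpace ℝ (Fin n₁)) : schwartzSlice u y x = u (x.ofLp, y) := rfl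

theorem integral_comp_ofLp {G : Type*} [NormedAddCommGroup G] [NormedSpace ℝ G]
    (f : (Fin n₁ → ℝ) → G) :
    ∫ x : EuclideanSpace ℝ (Fin n₁), f x.ofLp = ∫ x, f x :=
  (PiLp.volume_preserving_ofLp (Fin n₁)).integral_comp
    (MeasurableEquiv.toLp 2 (Fin n₁ → ℝ)).symm.measurableEmbedding f

theorem fourier_schwartzSlice (u : SchwartzMap ((Fin n₁ → ℝ) × (Fin n₂ → ℝ)) ℂ)
    (y : Fin n₂ → ℝ) (ξ : EuclideanSpace ℝ (Fin n₁)) :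
    𝓕 (schwartzSlice u y) ξ = partialFT u (ξ.ofLp, y) := by
  rw [SchwartzMap.fourier_coe, Real.fourier_eq', partialFT, ← integral_comp_ofLp]
  congr with x
  rw [smul_eq_mul, schwartzSlice_apply]
  congr 2
  simp [EuclideanSpace.inner_eq_star_dotProduct, dotProduct_comm]
  ring

theorem schwartzSlice_lineDerivOp (u : SchwartzMap ((Fin n₁ → ℝ) × (Fin n₂ → ℝ)) ℂ)
    (y : Fin n₂ → ℝ) (v : EuclideanSpace ℝ (Fin n₁)) :
    schwartzSlice (∂_{((v.ofLp, 0) : (Fin n₁ → ℝ) × (Fin n₂ → ℝ))} u) y =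
      ∂_{v} (schwartzSlice u y) := by
  ext x
  rw [schwartzSlice_apply, SchwartzMap.lineDerivOp_apply, SchwartzMap.lineDerivOp_apply]
  simp [lineDeriv, schwartzSlice_apply]

theorem partialFT_lineDerivOp (u : SchwartzMap ((Fin n₁ → ℝ) × (Fin n₂ → ℝ)) ℂ)
    (i : Fin n₁) (p : (Fin n₁ → ℝ) × (Fin n₂ → ℝ)) :
    partialFT
      (⇑(∂_{((Pi.single i 1, 0) : (Fin n₁ → ℝ) × (Fin n₂ → ℝ))} u :
        SchwartzMap ((Fin n₁ → ℝ) × (Fin n₂ → ℝ)) ℂ)) p =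
      (2 * Real.pi * Complex.I) * (p.1 i) * partialFT u p := by
  have h1 := fourier_schwartzSlice (∂_{((Pi.single i 1, 0) : (Fin n₁ → ℝ) × (Fin n₂ → ℝ))} u)
    p.2 (WithLp.toLp 2 p.1)
  have h2 := fourier_schwartzSlice u p.2 (WithLp.toLp 2 p.1)
  have h3 := schwartzSlice_lineDerivOp u p.2 (EuclideanSpace.single i 1)
  rw [PiLp.ofLp_single] at h3
  have hg : (inner ℝ · (EuclideanSpace.single i (1 : ℝ)) :
      EuclideanSpace ℝ (Fin n₁) → ℝ).HasTemperateGrowth :=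
    Function.hasTemperateGrowth_inner_left _
  rw [h3, SchwartzMap.fourier_lineDerivOp_eq] at h1
  simp only [_root_.smul_apply, SchwartzMap.smulLeftCLM_apply_apply hg, h2] at h1
  refine h1.symm.trans ?_
  simp [EuclideanSpace.inner_single_right, mul_assoc]

theorem partialFT_smul_snd (g : (Fin n₂ → ℝ) → ℝ) (u : (Fin n₁ → ℝ) × (Fin n₂ → ℝ) → ℂ)
    (p : (Fin n₁ → ℝ) × (Fin n₂ → ℝ)) :
    partialFT (fun q => g q.2 • u q) p = g p.2 • partialFT u p := by
  rw [partialFT, partialFT, ← integral_smul]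
  congr with x
  simp only [Complex.real_smul]
  ring

theorem stronglyMeasurable_partialFT (u : SchwartzMap ((Fin n₁ → ℝ) × (Fin n₂ → ℝ)) ℂ) :
    StronglyMeasurable (partialFT u) := by
  have h : Continuous (fun q : ((Fin n₁ → ℝ) × (Fin n₂ → ℝ)) × (Fin n₁ → ℝ) =>
      Complex.exp (-(2 * (Real.pi : ℂ) * Complex.I) * ((q.2 ⬝ᵥ q.1.1 : ℝ) : ℂ)) *
        u (q.2, q.1.2)) := by
    have := u.continuous
    simp only [dotProduct]
    fun_prop
  exact h.stronglyMeasurable.integral_prod_right'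

instance isAddHaarMeasure_volume_prod :
    (volume : Measure ((Fin n₁ → ℝ) × (Fin n₂ → ℝ))).IsAddHaarMeasure :=
  Measure.prod.instIsAddHaarMeasure _ _

theorem integrable_norm_sq (u : SchwartzMap ((Fin n₁ → ℝ) × (Fin n₂ → ℝ)) ℂ) :
    Integrable (fun p => ‖u p‖ ^ 2) :=
  (memLp_two_iff_integrable_sq_norm u.continuous.aestronglyMeasurable).1 (u.memLp 2)

theorem integral_norm_sq_partialFT_slice (u : SchwartzMap ((Fin n₁ → ℝ) × (Fin n₂ → ℝ)) ℂ)
    (y : Fin n₂ → ℝ) :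
    ∫ x, ‖partialFT u (x, y)‖ ^ 2 = ∫ x, ‖u (x, y)‖ ^ 2 := by
  rw [← integral_comp_ofLp, ← integral_comp_ofLp (fun x => ‖u (x, y)‖ ^ 2)]
  simp_rw [← fourier_schwartzSlice, ← schwartzSlice_apply]
  exact SchwartzMap.integral_norm_sq_fourier _

theorem integrable_norm_sq_partialFT (u : SchwartzMap ((Fin n₁ → ℝ) × (Fin n₂ → ℝ)) ℂ) :
    Integrable (fun p => ‖partialFT u p‖ ^ 2) := by
  refine (integrable_prod_iff' ?_).2 ⟨.of_forall fun y => ?_, ?_⟩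
  · exact ((stronglyMeasurable_partialFT u).norm.pow 2).aestronglyMeasurable
  · have h : Integrable (fun ξ => ‖𝓕 (schwartzSlice u y) ξ‖ ^ 2) :=
      (memLp_two_iff_integrable_sq_norm
        (𝓕 (schwartzSlice u y)).continuous.aestronglyMeasurable).1
        ((𝓕 (schwartzSlice u y)).memLp 2)
    simp_rw [fourier_schwartzSlice] at h
    exact ((PiLp.volume_preserving_ofLp (Fin n₁)).integrable_comp_emb
      (MeasurableEquiv.toLp 2 (Fin n₁ → ℝ)).symm.measurableEmbedding).1 h
  · simp only [norm_pow, norm_norm, integral_norm_sq_partialFT_slice]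
    exact (integrable_norm_sq u).integral_prod_right

theorem integral_norm_sq_partialFT (u : SchwartzMap ((Fin n₁ → ℝ) × (Fin n₂ → ℝ)) ℂ) :
    ∫ p, ‖partialFT u p‖ ^ 2 = ∫ p, ‖u p‖ ^ 2 := by
  rw [Measure.volume_eq_prod, integral_prod_symm _ (integrable_norm_sq_partialFT u),
    integral_prod_symm _ (integrable_norm_sq u)]
  simp_rw [integral_norm_sq_partialFT_slice]

end PartialParseval

section Uncertainty

open scoped LineDeriv

variable {n₁ n₂ : ℕ}

/-- The coordinate functionals of `ℝ^{n₁} × ℝ^{n₂}`. -/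
def coordCLM : Fin n₁ ⊕ Fin n₂ → ((Fin n₁ → ℝ) × (Fin n₂ → ℝ)) →L[ℝ] ℝ :=
  Sum.elim (fun i => (ContinuousLinearMap.proj i).comp (ContinuousLinearMap.fst ℝ _ _))
    (fun j => (ContinuousLinearMap.proj j).comp (ContinuousLinearMap.snd ℝ _ _))

/-- The standard basis vectors of `ℝ^{n₁} × ℝ^{n₂}`. -/
def basisVec : Fin n₁ ⊕ Fin n₂ → (Fin n₁ → ℝ) × (Fin n₂ → ℝ) :=
  Sum.elim (fun i => (Pi.single i 1, 0)) (fun j => (0, Pi.single j 1))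

theorem coordCLM_basisVec (i j : Fin n₁ ⊕ Fin n₂) :
    coordCLM i (basisVec j) = if i = j then 1 else 0 := by
  rcases i with i | i <;> rcases j with j | j <;>
    simp [coordCLM, basisVec, Pi.single_apply]

theorem sum_coordCLM_sq (p : (Fin n₁ → ℝ) × (Fin n₂ → ℝ)) :
    (∑ i, (p.1 i) ^ 2) + ∑ j, (p.2 j) ^ 2 = ∑ i, (coordCLM i p) ^ 2 := by
  simp [coordCLM]

theorem norm_sq_le_sum_coordCLM_sq (p : (Fin n₁ → ℝ) × (Fin n₂ → ℝ)) :
    ‖p‖ ^ 2 ≤ ∑ i, (coordCLM i p) ^ 2 := by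
  have h0 : 0 ≤ ∑ i, (coordCLM i p) ^ 2 := Finset.sum_nonneg fun i _ => sq_nonneg _
  have h (i : Fin n₁ ⊕ Fin n₂) : |coordCLM i p| ≤ √(∑ i, (coordCLM i p) ^ 2) :=
    Real.abs_le_sqrt (Finset.single_le_sum (f := fun i => (coordCLM i p) ^ 2)
      (fun i _ => sq_nonneg _) (Finset.mem_univ i))
  have hp : ‖p‖ ≤ √(∑ i, (coordCLM i p) ^ 2) :=
    max_le ((pi_norm_le_iff_of_nonneg (Real.sqrt_nonneg _)).2 fun i => h (Sum.inl i))
      ((pi_norm_le_iff_of_nonneg (Real.sqrt_nonneg _)).2 fun j => h (Sum.inr j))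
  calc ‖p‖ ^ 2 ≤ √(∑ i, (coordCLM i p) ^ 2) ^ 2 := by gcongr
    _ = _ := Real.sq_sqrt h0

/-- Multiplication of a Schwartz function by a coordinate. -/
def coordMul (i : Fin n₁ ⊕ Fin n₂) (u : SchwartzMap ((Fin n₁ → ℝ) × (Fin n₂ → ℝ)) ℂ) :
    SchwartzMap ((Fin n₁ → ℝ) × (Fin n₂ → ℝ)) ℂ :=
  SchwartzMap.smulLeftCLM ℂ (coordCLM i) u

theorem coordMul_apply (i : Fin n₁ ⊕ Fin n₂)
    (u : SchwartzMap ((Fin n₁ → ℝ) × (Fin n₂ → ℝ)) ℂ) (p : (Fin n₁ → ℝ) × (Fin n₂ → ℝ)) :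
    coordMul i u p = coordCLM i p • u p :=
  SchwartzMap.smulLeftCLM_apply_apply (coordCLM i).hasTemperateGrowth u p

/-- The partial derivative of a Schwartz function with respect to a coordinate. -/
def coordDeriv (i : Fin n₁ ⊕ Fin n₂) (u : SchwartzMap ((Fin n₁ → ℝ) × (Fin n₂ → ℝ)) ℂ) :
    SchwartzMap ((Fin n₁ → ℝ) × (Fin n₂ → ℝ)) ℂ :=
  ∂_{basisVec i} u

theorem norm_sq_coordMul (i : Fin n₁ ⊕ Fin n₂)
    (u : SchwartzMap ((Fin n₁ → ℝ) × (Fin n₂ → ℝ)) ℂ) (p : (Fin n₁ → ℝ) × (Fin n₂ → ℝ)) :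
    ‖coordMul i u p‖ ^ 2 = (coordCLM i p) ^ 2 * ‖u p‖ ^ 2 := by
  rw [coordMul_apply, norm_smul, mul_pow, Real.norm_eq_abs, sq_abs]

theorem coordDeriv_coordMul (i : Fin n₁ ⊕ Fin n₂)
    (u : SchwartzMap ((Fin n₁ → ℝ) × (Fin n₂ → ℝ)) ℂ) (p : (Fin n₁ → ℝ) × (Fin n₂ → ℝ)) :
    coordDeriv i (coordMul i u) p = u p + coordCLM i p • coordDeriv i u p := by
  rw [coordDeriv, coordDeriv, SchwartzMap.lineDerivOp_apply_eq_fderiv,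
    SchwartzMap.lineDerivOp_apply_eq_fderiv]
  have h : HasFDerivAt (fun q => coordCLM i q • u q) _ p :=
    (coordCLM i).hasFDerivAt.smul (u.hasFDerivAt p)
  have h' : (coordMul i u : (Fin n₁ → ℝ) × (Fin n₂ → ℝ) → ℂ) = fun q => coordCLM i q • u q :=
    funext (coordMul_apply i u)
  rw [h', h.fderiv]
  simp [coordCLM_basisVec, add_comm]

theorem integrable_inner_schwartz (u v : SchwartzMap ((Fin n₁ → ℝ) × (Fin n₂ → ℝ)) ℂ) :
    Integrable (fun p => inner ℝ (u p) (v p)) :=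
  (SchwartzMap.pairing (innerSL ℝ) u v).integrable

theorem integral_norm_sq_eq_neg_two_mul (i : Fin n₁ ⊕ Fin n₂)
    (u : SchwartzMap ((Fin n₁ → ℝ) × (Fin n₂ → ℝ)) ℂ) :
    ∫ p, ‖u p‖ ^ 2 = -2 * ∫ p, inner ℝ (coordMul i u p) (coordDeriv i u p) := by
  have h := SchwartzMap.integral_bilinear_lineDerivOp_right_eq_neg_left (μ := volume)
    (coordMul i u) u (innerSL ℝ) (basisVec i)
  change ∫ p, inner ℝ (coordMul i u p) (coordDeriv i u p) =
    -∫ p, inner ℝ (coordDeriv i (coordMul i u) p) (u p) at h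
  simp only [coordDeriv_coordMul, inner_add_left] at h
  have h1 (p : (Fin n₁ → ℝ) × (Fin n₂ → ℝ)) :
      inner ℝ (coordCLM i p • coordDeriv i u p) (u p) =
        inner ℝ (coordMul i u p) (coordDeriv i u p) := by
    rw [coordMul_apply, real_inner_smul_left, real_inner_smul_left, real_inner_comm]
  simp only [h1, real_inner_self_eq_norm_sq] at h
  rw [integral_add (integrable_norm_sq u) (integrable_inner_schwartz _ _)] at h
  linarith

theorem mul_integral_norm_sq_le (i : Fin n₁ ⊕ Fin n₂)
    (u : SchwartzMap ((Fin n₁ → ℝ) × (Fin n₂ → ℝ)) ℂ) (t : ℝ) :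
    t * ∫ p, ‖u p‖ ^ 2 ≤
      t ^ 2 * (∫ p, ‖coordMul i u p‖ ^ 2) + ∫ p, ‖coordDeriv i u p‖ ^ 2 := by
  have h : 0 ≤ ∫ p, ‖t • coordMul i u p + coordDeriv i u p‖ ^ 2 :=
    integral_nonneg fun p => sq_nonneg _
  have h1 (p : (Fin n₁ → ℝ) × (Fin n₂ → ℝ)) :
      ‖t • coordMul i u p + coordDeriv i u p‖ ^ 2 = (t ^ 2 * ‖coordMul i u p‖ ^ 2 +
        2 * t * inner ℝ (coordMul i u p) (coordDeriv i u p)) + ‖coordDeriv i u p‖ ^ 2 := by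
    rw [norm_add_sq_real, real_inner_smul_left, norm_smul, mul_pow, Real.norm_eq_abs, sq_abs]
    ring
  have i1 := (integrable_norm_sq (coordMul i u)).const_mul (t ^ 2)
  have i2 := (integrable_inner_schwartz (coordMul i u) (coordDeriv i u)).const_mul (2 * t)
  have i3 : Integrable fun p => t ^ 2 * ‖coordMul i u p‖ ^ 2 +
      2 * t * inner ℝ (coordMul i u p) (coordDeriv i u p) := i1.add i2
  simp only [h1] at h
  rw [integral_add i3 (integrable_norm_sq _), integral_add i1 i2, integral_const_mul,
    integral_const_mul] at h
  rw [integral_norm_sq_eq_neg_two_mul i u]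
  linarith

theorem variance_eq_sum (u : SchwartzMap ((Fin n₁ → ℝ) × (Fin n₂ → ℝ)) ℂ) :
    variance u = ∑ i, ∫ p, ‖coordMul i u p‖ ^ 2 := by
  rw [← integral_finsetSum _ fun i _ => integrable_norm_sq _]
  simp_rw [norm_sq_coordMul, ← Finset.sum_mul, ← sum_coordCLM_sq]
  rfl

theorem norm_sq_partialFT_lineDerivOp (i : Fin n₁)
    (u : SchwartzMap ((Fin n₁ → ℝ) × (Fin n₂ → ℝ)) ℂ) (p : (Fin n₁ → ℝ) × (Fin n₂ → ℝ)) :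
    (coordCLM (Sum.inl i) p) ^ 2 * ‖partialFT u p‖ ^ 2 = (4 * Real.pi ^ 2)⁻¹ *
      ‖partialFT (coordDeriv (Sum.inl i) u) p‖
        ^ 2 := by
  simp only [coordDeriv, basisVec, Sum.elim_inl]
  rw [partialFT_lineDerivOp]
  simp only [norm_mul, Complex.norm_I, Complex.norm_real, Real.norm_eq_abs, mul_pow, sq_abs,
    coordCLM, Sum.elim_inl, ContinuousLinearMap.comp_apply, ContinuousLinearMap.proj_apply,
    ContinuousLinearMap.coe_fst', Complex.norm_ofNat]
  field_simp
  norm_num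

theorem norm_sq_partialFT_coordMul (j : Fin n₂)
    (u : SchwartzMap ((Fin n₁ → ℝ) × (Fin n₂ → ℝ)) ℂ) (p : (Fin n₁ → ℝ) × (Fin n₂ → ℝ)) :
    (coordCLM (Sum.inr j) p) ^ 2 * ‖partialFT u p‖ ^ 2 =
      ‖partialFT (coordMul (Sum.inr j) u) p‖ ^ 2 := by
  have h : (coordMul (Sum.inr j) u : (Fin n₁ → ℝ) × (Fin n₂ → ℝ) → ℂ) =
      fun q => (fun y : Fin n₂ → ℝ => y j) q.2 • u q := funext (coordMul_apply _ u)
  rw [h, partialFT_smul_snd (fun y : Fin n₂ → ℝ => y j) u p, norm_smul, mul_pow, Real.norm_eq_abs, sq_abs]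
  rfl

theorem variance_partialFT_eq_sum (u : SchwartzMap ((Fin n₁ → ℝ) × (Fin n₂ → ℝ)) ℂ) :
    variance (partialFT u) =
      (4 * Real.pi ^ 2)⁻¹ * (∑ i, ∫ p, ‖coordDeriv (Sum.inl i) u p‖ ^ 2) +
        ∑ j, ∫ p, ‖coordMul (Sum.inr j) u p‖ ^ 2 := by
  simp_rw [variance, sum_coordCLM_sq, Fintype.sum_sum_type, add_mul, Finset.sum_mul,
    norm_sq_partialFT_lineDerivOp, norm_sq_partialFT_coordMul]
  rw [integral_add, integral_finsetSum, integral_finsetSum, Finset.mul_sum]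
  · simp_rw [integral_const_mul, integral_norm_sq_partialFT]
  · exact fun i _ => integrable_norm_sq_partialFT _
  · exact fun i _ => (integrable_norm_sq_partialFT _).const_mul _
  · exact integrable_finsetSum _ fun i _ => (integrable_norm_sq_partialFT _).const_mul _
  · exact integrable_finsetSum _ fun i _ => integrable_norm_sq_partialFT _

theorem le_sqrt_variance_partialFT_mul (u : SchwartzMap ((Fin n₁ → ℝ) × (Fin n₂ → ℝ)) ℂ)
    (hu : ∫ p, ‖u p‖ ^ 2 = 1) :
    n₁ / (4 * Real.pi) ≤ √(variance (partialFT u) * variance u) := by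
  set A := ∑ i : Fin n₁, ∫ p, ‖coordMul (Sum.inl i) u p‖ ^ 2 with hA
  set B := ∑ i : Fin n₁, ∫ p, ‖coordDeriv (Sum.inl i) u p‖ ^ 2 with hB
  set R := ∑ j : Fin n₂, ∫ p, ‖coordMul (Sum.inr j) u p‖ ^ 2 with hR
  have hA0 : 0 ≤ A := Finset.sum_nonneg fun i _ => integral_nonneg fun p => sq_nonneg _
  have hB0 : 0 ≤ B := Finset.sum_nonneg fun i _ => integral_nonneg fun p => sq_nonneg _
  have hR0 : 0 ≤ R := Finset.sum_nonneg fun i _ => integral_nonneg fun p => sq_nonneg _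
  have hV : variance u = A + R := by rw [variance_eq_sum, Fintype.sum_sum_type]
  have hW : variance (partialFT u) = (4 * Real.pi ^ 2)⁻¹ * B + R := variance_partialFT_eq_sum u
  have hquad (t : ℝ) : 0 ≤ A * (t * t) + (-n₁) * t + B := by
    have h := Finset.sum_le_sum fun (i : Fin n₁) (_ : i ∈ Finset.univ) =>
      mul_integral_norm_sq_le (Sum.inl i) u t
    rw [hu, Finset.sum_add_distrib, ← Finset.mul_sum (f := fun i => ∫ p, ‖coordMul (Sum.inl i) u p‖ ^ 2),
      ← hA, ← hB, Finset.sum_const, Finset.card_univ, Fintype.card_fin, nsmul_eq_mul] at h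
    linarith
  have hdisc := discrim_le_zero hquad
  rw [discrim] at hdisc
  refine Real.le_sqrt_of_sq_le ?_
  rw [hV, hW]
  calc (n₁ / (4 * Real.pi)) ^ 2 = (4 * Real.pi ^ 2)⁻¹ * ((n₁ : ℝ) ^ 2 / 4) := by
        field_simp
    _ ≤ (4 * Real.pi ^ 2)⁻¹ * (B * A) := by
        gcongr
        linarith
    _ = ((4 * Real.pi ^ 2)⁻¹ * B) * A := by ring
    _ ≤ _ := by
        gcongr <;> linarith

/-- The quadratic form `π (|x|² + a |y|²)`. -/
def gaussExponent (n₁ n₂ : ℕ) (a : ℝ) (p : (Fin n₁ → ℝ) × (Fin n₂ → ℝ)) : ℝ :=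
  ∑ i, Real.pi * Sum.elim (fun _ => 1) (fun _ => a) i * (coordCLM i p) ^ 2

theorem gaussExponent_hasTemperateGrowth (a : ℝ) :
    (gaussExponent n₁ n₂ a).HasTemperateGrowth := by
  refine Function.HasTemperateGrowth.sum fun i _ => ?_
  have := (coordCLM i).hasTemperateGrowth
  fun_prop

theorem norm_sq_le_gaussExponent {a : ℝ} (ha : 1 ≤ a) (p : (Fin n₁ → ℝ) × (Fin n₂ → ℝ)) :
    ‖p‖ ^ 2 ≤ gaussExponent n₁ n₂ a p := by
  refine (norm_sq_le_sum_coordCLM_sq p).trans (Finset.sum_le_sum fun i _ => ?_)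
  refine le_mul_of_one_le_left (sq_nonneg _) ?_
  have := Real.pi_gt_three
  rcases i with i | i <;> simp <;> nlinarith

theorem fderiv_gaussExponent (a : ℝ) (p : (Fin n₁ → ℝ) × (Fin n₂ → ℝ)) (j : Fin n₁ ⊕ Fin n₂) :
    fderiv ℝ (gaussExponent n₁ n₂ a) p (basisVec j) =
      2 * Real.pi * Sum.elim (fun _ => 1) (fun _ => a) j * coordCLM j p := by
  have h : HasFDerivAt (gaussExponent n₁ n₂ a) _ p := HasFDerivAt.fun_sum fun i _ =>
    (((coordCLM i).hasFDerivAt (x := p)).pow 2).const_mul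
      (Real.pi * Sum.elim (fun _ => 1) (fun _ => a) i)
  rw [h.fderiv]
  simp [coordCLM_basisVec, -Fintype.sum_sum_type]
  ring

theorem exists_schwartz_gaussian (n₁ n₂ : ℕ) {a : ℝ} (ha : 1 ≤ a) :
    ∃ u : SchwartzMap ((Fin n₁ → ℝ) × (Fin n₂ → ℝ)) ℂ, ∫ p, ‖u p‖ ^ 2 = 1 ∧
      ∀ i p, coordDeriv i u p =
        -(2 * Real.pi * Sum.elim (fun _ => 1) (fun _ => a) i) • coordMul i u p := by
  set g := expNegSchwartz (gaussExponent n₁ n₂ a) (gaussExponent_hasTemperateGrowth a)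
    (norm_sq_le_gaussExponent ha) with hg
  have hpos : 0 < ∫ p, ‖g p‖ ^ 2 := by
    refine integral_pos_of_integrable_nonneg_nonzero (x := 0) (by fun_prop)
      (integrable_norm_sq g) (fun p => sq_nonneg _) ?_
    simp [hg, expNegSchwartz_apply]
  refine ⟨(√(∫ p, ‖g p‖ ^ 2))⁻¹ • g, ?_, fun i p => ?_⟩
  · simp only [_root_.smul_apply, norm_smul, mul_pow]
    rw [integral_const_mul, norm_inv, inv_pow, Real.norm_eq_abs, sq_abs, Real.sq_sqrt hpos.le,
      inv_mul_cancel₀ hpos.ne']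
  · rw [coordDeriv, LineDeriv.lineDerivOp_smul, coordMul_apply, _root_.smul_apply, _root_.smul_apply, hg,
      lineDerivOp_expNegSchwartz, fderiv_gaussExponent, smul_smul, smul_smul, smul_smul]
    ring_nf

theorem integral_norm_sq_coordMul_of_gaussian {u : SchwartzMap ((Fin n₁ → ℝ) × (Fin n₂ → ℝ)) ℂ}
    (hu : ∫ p, ‖u p‖ ^ 2 = 1) {i : Fin n₁ ⊕ Fin n₂} {c : ℝ} (hc : c ≠ 0)
    (h : ∀ p, coordDeriv i u p = -(2 * c) • coordMul i u p) :
    ∫ p, ‖coordMul i u p‖ ^ 2 = 1 / (4 * c) := by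
  have h1 := integral_norm_sq_eq_neg_two_mul i u
  simp only [h, real_inner_smul_right, real_inner_self_eq_norm_sq] at h1
  rw [integral_const_mul, hu] at h1
  field_simp
  linarith

theorem exists_sqrt_variance_partialFT_mul_eq (n₁ n₂ : ℕ) {a : ℝ} (ha : 1 ≤ a) :
    ∃ u : SchwartzMap ((Fin n₁ → ℝ) × (Fin n₂ → ℝ)) ℂ, ∫ p, ‖u p‖ ^ 2 = 1 ∧
      √(variance (partialFT u) * variance u) = (n₁ + n₂ / a) / (4 * Real.pi) := by
  obtain ⟨u, hu, hd⟩ := exists_schwartz_gaussian n₁ n₂ ha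
  have ha0 : 0 < a := by linarith
  refine ⟨u, hu, ?_⟩
  have h1 (i : Fin n₁) : ∫ p, ‖coordMul (Sum.inl i) u p‖ ^ 2 = 1 / (4 * Real.pi) :=
    integral_norm_sq_coordMul_of_gaussian hu Real.pi_ne_zero fun p => by simpa using hd (Sum.inl i) p
  have h2 (j : Fin n₂) : ∫ p, ‖coordMul (Sum.inr j) u p‖ ^ 2 = 1 / (4 * (Real.pi * a)) :=
    integral_norm_sq_coordMul_of_gaussian hu (by positivity) fun p => by
      simpa [mul_assoc] using hd (Sum.inr j) p
  have h3 (i : Fin n₁) : ∫ p, ‖coordDeriv (Sum.inl i) u p‖ ^ 2 = Real.pi := by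
    simp only [hd, norm_smul, mul_pow, integral_const_mul, h1]
    simp only [Real.norm_eq_abs, sq_abs, Sum.elim_inl]
    field_simp
    norm_num
  have hV : variance u = (n₁ + n₂ / a) / (4 * Real.pi) := by
    simp only [variance_eq_sum, Fintype.sum_sum_type, h1, h2, Finset.sum_const,
      Finset.card_univ, Fintype.card_fin, nsmul_eq_mul]
    field_simp
  have hW : variance (partialFT u) = (n₁ + n₂ / a) / (4 * Real.pi) := by
    simp only [variance_partialFT_eq_sum, h2, h3, Finset.sum_const,
      Finset.card_univ, Fintype.card_fin, nsmul_eq_mul]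
    field_simp
  rw [hV, hW, Real.sqrt_mul_self (by positivity)]

end Uncertainty

/-- `μ(F_{n₁}) = n₁/(4π)` for the partial Fourier transformation in `n₁` of the
`n = n₁ + n₂` variables. -/
theorem mu_partialFT_eq {n n₁ n₂ : ℕ} (hn : n = n₁ + n₂) (hn₁ : 1 ≤ n₁) :
    mu (partialFT (n₁ := n₁) (n₂ := n₂)) = n₁ / (4 * Real.pi) := by
  have hlow : ∀ r ∈ { r : ℝ | ∃ u : SchwartzMap ((Fin n₁ → ℝ) × (Fin n₂ → ℝ)) ℂ,
      (∫ p, ‖u p‖ ^ 2) = 1 ∧ r = Real.sqrt (variance (partialFT ⇑u) * variance ⇑u) },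
      n₁ / (4 * Real.pi) ≤ r := by
    rintro r ⟨u, hu, rfl⟩
    exact le_sqrt_variance_partialFT_mul u hu
  have hmem (k : ℕ) : ((n₁ : ℝ) + n₂ / ((k : ℝ) + 1)) / (4 * Real.pi) ∈
      { r : ℝ | ∃ u : SchwartzMap ((Fin n₁ → ℝ) × (Fin n₂ → ℝ)) ℂ,
        (∫ p, ‖u p‖ ^ 2) = 1 ∧ r = Real.sqrt (variance (partialFT ⇑u) * variance ⇑u) } := by
    obtain ⟨u, hu, h⟩ := exists_sqrt_variance_partialFT_mul_eq n₁ n₂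
      (a := (k : ℝ) + 1) (by linarith [k.cast_nonneg (α := ℝ)])
    exact ⟨u, hu, h.symm⟩
  refine le_antisymm ?_ (le_csInf ⟨_, hmem 0⟩ hlow)
  have hlim : Filter.Tendsto (fun k : ℕ => ((n₁ : ℝ) + n₂ / ((k : ℝ) + 1)) / (4 * Real.pi))
      Filter.atTop (nhds (((n₁ : ℝ) + 0) / (4 * Real.pi))) := by
    refine (Filter.Tendsto.const_add _ ?_).div_const _
    simpa [div_eq_mul_inv] using
      (tendsto_one_div_add_atTop_nhds_zero_nat (𝕜 := ℝ)).const_mul (n₂ : ℝ)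
  rw [add_zero] at hlim
  exact ge_of_tendsto' hlim fun k => csInf_le ⟨_, hlow⟩ (hmem k)

end
end

section
/- Let n ≥ 1, let C be a real symmetric n×n matrix and let Ω be a real symmetric positive-definite n×n matrix. Then the infimum over Schwartz functions v on ℝⁿ with ‖v‖_{L²(ℝⁿ)} = 1 of the quantity ∫_{ℝⁿ} ‖Ωx‖² |v(x)|² dx + Σ_{j=1}^{n} ‖xⱼ v + Σ_{k=1}^{n} C_{jk} D_k v‖²_{L²(ℝⁿ)} is at most (1/(2π))·trace(√(C Ω² C)), where √(C Ω² C) is the positive semidefinite square root of the positive semidefinite matrix C Ω² C. (The displayed quantity equals ⟨H_{C,Ω} v, v⟩ for H_{C,Ω} the Weyl quantization of the symbol ‖Ωx‖² + ‖Cξ + x‖².) -/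
open MeasureTheory Matrix

noncomputable section

/-- The operator `D_k = (1/(2πi)) ∂/∂x_k`. -/
def Dop {n : ℕ} (k : Fin n) (f : (Fin n → ℝ) → ℂ) : (Fin n → ℝ) → ℂ :=
  fun x => (1 / (2 * (Real.pi : ℂ) * Complex.I)) * fderiv ℝ f x (Pi.single k 1)

theorem Complex.norm_iteratedFDeriv_real_exp (i : ℕ) (z : ℂ) :
    ‖iteratedFDeriv ℝ i Complex.exp z‖ = Real.exp z.re := by
  have h : ContDiffAt ℂ i Complex.exp z := Complex.contDiff_exp.contDiffAt
  rw [← h.restrictScalars_iteratedFDeriv (𝕜 := ℝ), Function.comp_apply,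
    ContinuousMultilinearMap.norm_restrictScalars, norm_iteratedFDeriv_eq_norm_iteratedDeriv,
    iteratedDeriv_eq_iterate, Complex.iter_deriv_exp, Complex.norm_exp]

theorem Real.one_add_pow_mul_exp_neg_mul_sq_le {a : ℝ} (ha : 0 < a) (N : ℕ) {r : ℝ} (hr : 0 ≤ r) :
    (1 + r) ^ N * Real.exp (-a * r ^ 2) ≤ (2 / a) ^ N * N.factorial * Real.exp a := by
  have h1 : 1 + r ≤ 2 / a * (a * (1 + r ^ 2)) := by
    rw [← mul_assoc, div_mul_cancel₀ _ ha.ne']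
    nlinarith [sq_nonneg (r - 1)]
  have h2 : (a * (1 + r ^ 2)) ^ N ≤ N.factorial * Real.exp (a * (1 + r ^ 2)) := by
    have := Real.pow_div_factorial_le_exp (x := a * (1 + r ^ 2)) (by positivity) N
    rw [div_le_iff₀ (by positivity)] at this
    linarith
  calc (1 + r) ^ N * Real.exp (-a * r ^ 2)
      ≤ (2 / a * (a * (1 + r ^ 2))) ^ N * Real.exp (-a * r ^ 2) := by gcongr
    _ ≤ ((2 / a) ^ N * (N.factorial * Real.exp (a * (1 + r ^ 2)))) * Real.exp (-a * r ^ 2) := by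
        rw [mul_pow]; gcongr
    _ = (2 / a) ^ N * N.factorial * (Real.exp (a * (1 + r ^ 2)) * Real.exp (-a * r ^ 2)) := by
        ring
    _ = _ := by rw [← Real.exp_add]; ring_nf

/-- The exponential of a function of temperate growth whose real part is bounded above by
`-a ‖x‖ ^ 2` with `a > 0` is a Schwartz function. -/
theorem SchwartzMap.exists_eq_exp {E : Type*} [NormedAddCommGroup E] [NormedSpace ℝ E]
    {f : E → ℂ} (hf : f.HasTemperateGrowth) {a : ℝ} (ha : 0 < a)
    (hre : ∀ x, (f x).re ≤ -a * ‖x‖ ^ 2) :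
    ∃ v : SchwartzMap E ℂ, ∀ x, v x = Complex.exp (f x) := by
  refine ⟨⟨fun x => Complex.exp (f x), Complex.contDiff_exp.comp hf.1, fun k n => ?_⟩,
    fun x => rfl⟩
  obtain ⟨m, B, hB, hD⟩ := hf.norm_iteratedFDeriv_le_uniform n
  refine ⟨n.factorial * (1 + B) ^ n *
    ((2 / a) ^ (k + m * n) * (k + m * n).factorial * Real.exp a), fun x => ?_⟩
  have hx := norm_nonneg x
  have h1 : 1 ≤ (1 + B) * (1 + ‖x‖) ^ m :=
    one_le_mul_of_one_le_of_one_le (by linarith) (one_le_pow₀ (by linarith))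
  have key : ‖iteratedFDeriv ℝ n (Complex.exp ∘ f) x‖ ≤
      n.factorial * Real.exp (-a * ‖x‖ ^ 2) * ((1 + B) * (1 + ‖x‖) ^ m) ^ n := by
    refine norm_iteratedFDeriv_comp_le (N := n) (Complex.contDiff_exp)
      (hf.1.of_le (mod_cast le_top)) le_rfl x (fun i _ => ?_) (fun i hi hin => ?_)
    · rw [Complex.norm_iteratedFDeriv_real_exp]
      exact Real.exp_le_exp.2 (hre x)
    · refine (hD i hin x).trans (le_trans ?_ (le_self_pow₀ h1 (by omega)))
      gcongr
      linarith
  calc ‖x‖ ^ k * ‖iteratedFDeriv ℝ n (fun x => Complex.exp (f x)) x‖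
      ≤ (1 + ‖x‖) ^ k *
        (n.factorial * Real.exp (-a * ‖x‖ ^ 2) * ((1 + B) * (1 + ‖x‖) ^ m) ^ n) := by
        gcongr
        · linarith
        · exact key
    _ = n.factorial * (1 + B) ^ n * ((1 + ‖x‖) ^ (k + m * n) * Real.exp (-a * ‖x‖ ^ 2)) := by
        rw [mul_pow, ← pow_mul, pow_add]; ring
    _ ≤ _ := by
        refine mul_le_mul_of_nonneg_left ?_ (by positivity)
        exact Real.one_add_pow_mul_exp_neg_mul_sq_le ha _ hx

theorem integral_sq_mul_exp_neg_mul_sq {b : ℝ} (hb : 0 < b) :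
    ∫ t : ℝ, t ^ 2 * Real.exp (-b * t ^ 2) = 1 / (2 * b) * ∫ t : ℝ, Real.exp (-b * t ^ 2) := by
  have h2 : Integrable fun t : ℝ => t ^ 2 * Real.exp (-b * t ^ 2) := by
    simpa using integrable_rpow_mul_exp_neg_mul_sq hb (s := 2) (by norm_num)
  have h := integral_mul_deriv_eq_deriv_mul_of_integrable (u := fun t : ℝ => t)
    (v := fun t => Real.exp (-b * t ^ 2)) (u' := fun _ => 1)
    (v' := fun t => Real.exp (-b * t ^ 2) * (-b * (2 * t)))
    (fun t _ => hasDerivAt_id t)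
    (fun t _ => by simpa using (((hasDerivAt_pow 2 t).const_mul (-b)).exp))
    ((h2.const_mul (-2 * b)).congr (.of_forall fun t => by simp; ring))
    (by simpa [Pi.mul_def] using integrable_exp_neg_mul_sq hb)
    (by simpa [Pi.mul_def] using integrable_mul_exp_neg_mul_sq hb)
  have e : ∀ t : ℝ, t * (Real.exp (-b * t ^ 2) * (-b * (2 * t))) =
    (-2 * b) * (t ^ 2 * Real.exp (-b * t ^ 2)) := fun t => by ring
  simp only [e, integral_const_mul, one_mul] at h
  rw [div_mul_eq_mul_div, one_mul, eq_div_iff (by positivity)]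
  linarith

theorem integral_mul_exp_neg_mul_sq_eq_zero (b : ℝ) :
    ∫ t : ℝ, t * Real.exp (-b * t ^ 2) = 0 := by
  have h := integral_neg_eq_self (fun t : ℝ => t * Real.exp (-b * t ^ 2)) volume
  simp only [neg_mul, even_two, Even.neg_pow, integral_neg] at h ⊢
  linarith

theorem dotProduct_sq_mul_exp {ι : Type*} [Fintype ι] (b : ℝ) (m y : ι → ℝ) :
    (m ⬝ᵥ y) ^ 2 * Real.exp (-b * ∑ k, y k ^ 2) =
      ∑ i, ∑ j, m i * m j * (y i * y j * Real.exp (-b * ∑ k, y k ^ 2)) := by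
  rw [sq, dotProduct, Finset.sum_mul_sum, Finset.sum_mul]
  simp_rw [Finset.sum_mul]
  exact Finset.sum_congr rfl fun i _ => Finset.sum_congr rfl fun j _ => by ring

section Gaussian

variable {ι : Type*} [Fintype ι] [DecidableEq ι]

theorem mul_mul_exp_neg_mul_sum_sq (b : ℝ) (i j : ι) (y : ι → ℝ) :
    y i * y j * Real.exp (-b * ∑ k, y k ^ 2) =
      ∏ k, ((if k = i then y k else 1) * (if k = j then y k else 1)) *
        Real.exp (-b * y k ^ 2) := by
  simp only [Finset.prod_mul_distrib, Finset.mul_sum, Real.exp_sum, Finset.prod_ite_eq',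
    Finset.mem_univ, if_true]

theorem integrable_mul_mul_exp_neg_mul_sum_sq {b : ℝ} (hb : 0 < b) (i j : ι) :
    Integrable fun y : ι → ℝ => y i * y j * Real.exp (-b * ∑ k, y k ^ 2) := by
  simp_rw [mul_mul_exp_neg_mul_sum_sq]
  refine Integrable.fintype_prod (f := fun k t => ((if k = i then t else 1) *
    (if k = j then t else 1)) * Real.exp (-b * t ^ 2)) fun k => ?_
  have h0 := integrable_exp_neg_mul_sq hb
  have h1 := integrable_mul_exp_neg_mul_sq hb
  have h2 : Integrable fun t : ℝ => t ^ 2 * Real.exp (-b * t ^ 2) := by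
    simpa using integrable_rpow_mul_exp_neg_mul_sq hb (s := 2) (by norm_num)
  split_ifs <;> simpa only [← sq, one_mul, mul_one, one_pow]

theorem integral_mul_mul_exp_neg_mul_sum_sq {b : ℝ} (hb : 0 < b) (i j : ι) :
    ∫ y : ι → ℝ, y i * y j * Real.exp (-b * ∑ k, y k ^ 2) =
      if i = j then 1 / (2 * b) * ∫ y : ι → ℝ, Real.exp (-b * ∑ k, y k ^ 2) else 0 := by
  have hZ : ∫ y : ι → ℝ, Real.exp (-b * ∑ k, y k ^ 2) =
      ∏ _k : ι, ∫ t : ℝ, Real.exp (-b * t ^ 2) := by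
    simp_rw [Finset.mul_sum, Real.exp_sum]
    exact integral_fintype_prod_volume_eq_prod fun _ t => Real.exp (-b * t ^ 2)
  simp_rw [mul_mul_exp_neg_mul_sum_sq, hZ]
  rw [integral_fintype_prod_volume_eq_prod fun k t => ((if k = i then t else 1) *
    (if k = j then t else 1)) * Real.exp (-b * t ^ 2)]
  split_ifs with h
  · subst h
    have e : ∀ k : ι, ∫ t : ℝ, ((if k = i then t else 1) * (if k = i then t else 1)) *
        Real.exp (-b * t ^ 2) =
        (if k = i then 1 / (2 * b) else 1) * ∫ t : ℝ, Real.exp (-b * t ^ 2) := by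
      intro k
      split_ifs
      · simp_rw [← sq]
        exact integral_sq_mul_exp_neg_mul_sq hb
      · simp
    simp_rw [e, Finset.prod_mul_distrib, Finset.prod_ite_eq', Finset.mem_univ, if_true]
  · refine Finset.prod_eq_zero (Finset.mem_univ i) ?_
    simpa [h] using integral_mul_exp_neg_mul_sq_eq_zero b

theorem integrable_dotProduct_sq_mul_exp {b : ℝ} (hb : 0 < b) (m : ι → ℝ) :
    Integrable fun y : ι → ℝ => (m ⬝ᵥ y) ^ 2 * Real.exp (-b * ∑ k, y k ^ 2) := by
  simp_rw [dotProduct_sq_mul_exp]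
  exact integrable_finsetSum _ fun i _ => integrable_finsetSum _ fun j _ =>
    (integrable_mul_mul_exp_neg_mul_sum_sq hb i j).const_mul _

theorem integral_dotProduct_sq_mul_exp {b : ℝ} (hb : 0 < b) (m : ι → ℝ) :
    ∫ y : ι → ℝ, (m ⬝ᵥ y) ^ 2 * Real.exp (-b * ∑ k, y k ^ 2) =
      1 / (2 * b) * (m ⬝ᵥ m) * ∫ y : ι → ℝ, Real.exp (-b * ∑ k, y k ^ 2) := by
  have hI (i j : ι) := (integrable_mul_mul_exp_neg_mul_sum_sq hb i j).const_mul (m i * m j)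
  simp_rw [dotProduct_sq_mul_exp]
  rw [integral_finsetSum _ fun i _ => integrable_finsetSum _ fun j _ => hI i j]
  simp_rw [integral_finsetSum _ fun j _ => hI _ j, integral_const_mul,
    integral_mul_mul_exp_neg_mul_sum_sq hb]
  simp only [mul_ite, mul_zero, Finset.sum_ite_eq, Finset.mem_univ, if_true, dotProduct,
    Finset.mul_sum, Finset.sum_mul]
  exact Finset.sum_congr rfl fun i _ => by ring

theorem Matrix.measurableEmbedding_toLin' {G : Matrix ι ι ℝ} (hG : G.det ≠ 0) :
    MeasurableEmbedding (toLin' G) :=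
  (LinearEquiv.ofIsUnitDet (f := toLin' G) (v := Pi.basisFun ℝ ι) (v' := Pi.basisFun ℝ ι) (by
    simpa [LinearMap.toMatrix_eq_toMatrix'] using
      hG)).toContinuousLinearEquiv.toHomeomorph.measurableEmbedding

/-- Linear change of variables for an invertible matrix. -/
theorem Matrix.integral_comp_mulVec {G : Matrix ι ι ℝ} (hG : G.det ≠ 0) (F : (ι → ℝ) → ℝ) :
    ∫ x, F (G *ᵥ x) = |G.det⁻¹| * ∫ y, F y := by
  have h := (measurableEmbedding_toLin' hG).integral_map (μ := volume) F
  rw [Real.map_matrix_volume_pi_eq_smul_volume_pi hG, integral_smul_measure] at h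
  simpa using h.symm

theorem Matrix.integrable_comp_mulVec {G : Matrix ι ι ℝ} (hG : G.det ≠ 0) {F : (ι → ℝ) → ℝ}
    (hF : Integrable F) : Integrable fun x => F (G *ᵥ x) := by
  have h := (measurableEmbedding_toLin' hG).integrable_map_iff (μ := volume) (g := F)
  rw [Real.map_matrix_volume_pi_eq_smul_volume_pi hG] at h
  exact h.1 (hF.smul_measure ENNReal.ofReal_ne_top)

theorem Matrix.dotProduct_eq_vecMul_inv_dotProduct_mulVec {G : Matrix ι ι ℝ} (hG : G.det ≠ 0)
    (m x : ι → ℝ) : m ⬝ᵥ x = (m ᵥ* G⁻¹) ⬝ᵥ (G *ᵥ x) := by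
  rw [dotProduct_mulVec, vecMul_vecMul, nonsing_inv_mul _ hG.isUnit, vecMul_one]

theorem integrable_dotProduct_sq_mul_exp_mulVec {b : ℝ} (hb : 0 < b) {G : Matrix ι ι ℝ}
    (hG : G.det ≠ 0) (m : ι → ℝ) :
    Integrable fun x : ι → ℝ => (m ⬝ᵥ x) ^ 2 * Real.exp (-b * ∑ k, (G *ᵥ x) k ^ 2) := by
  simp_rw [dotProduct_eq_vecMul_inv_dotProduct_mulVec hG m]
  exact integrable_comp_mulVec hG (integrable_dotProduct_sq_mul_exp hb (m ᵥ* G⁻¹))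

theorem integral_dotProduct_sq_mul_exp_mulVec {b : ℝ} (hb : 0 < b) {G : Matrix ι ι ℝ}
    (hG : G.det ≠ 0) (m : ι → ℝ) :
    ∫ x : ι → ℝ, (m ⬝ᵥ x) ^ 2 * Real.exp (-b * ∑ k, (G *ᵥ x) k ^ 2) =
      1 / (2 * b) * ((m ᵥ* G⁻¹) ⬝ᵥ (m ᵥ* G⁻¹)) *
        ∫ x : ι → ℝ, Real.exp (-b * ∑ k, (G *ᵥ x) k ^ 2) := by
  simp_rw [dotProduct_eq_vecMul_inv_dotProduct_mulVec hG m]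
  rw [integral_comp_mulVec hG (fun y => ((m ᵥ* G⁻¹) ⬝ᵥ y) ^ 2 * Real.exp (-b * ∑ k, y k ^ 2)),
    integral_comp_mulVec hG (fun y => Real.exp (-b * ∑ k, y k ^ 2)),
    integral_dotProduct_sq_mul_exp hb]
  ring

theorem integral_exp_mulVec_pos {b : ℝ} (hb : 0 < b) {G : Matrix ι ι ℝ} (hG : G.det ≠ 0) :
    0 < ∫ x : ι → ℝ, Real.exp (-b * ∑ k, (G *ᵥ x) k ^ 2) := by
  rw [integral_comp_mulVec hG (fun y => Real.exp (-b * ∑ k, y k ^ 2))]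
  refine mul_pos (by simpa using hG) ?_
  simp_rw [Finset.mul_sum, Real.exp_sum]
  rw [integral_fintype_prod_volume_eq_prod fun _ t => Real.exp (-b * t ^ 2)]
  refine Finset.prod_pos fun _ _ => ?_
  rw [integral_gaussian]
  positivity

end Gaussian

theorem hasTemperateGrowth_dotProduct_mulVec {ι : Type*} [Fintype ι] (P : Matrix ι ι ℝ) :
    (fun x : ι → ℝ => x ⬝ᵥ P *ᵥ x).HasTemperateGrowth := by
  have h (i : ι) : (fun x : ι → ℝ => x i).HasTemperateGrowth :=
    (ContinuousLinearMap.proj (R := ℝ) (φ := fun _ : ι => ℝ) i).hasTemperateGrowth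
  simp only [dotProduct, mulVec]
  exact .sum fun i _ => (h i).mul (.sum fun j _ => (Function.HasTemperateGrowth.const _).mul (h j))

theorem hasLineDerivAt_dotProduct_mulVec {ι : Type*} [Fintype ι] [DecidableEq ι]
    {P : Matrix ι ι ℝ} (hP : P.IsSymm) (x : ι → ℝ) (k : ι) :
    HasLineDerivAt ℝ (fun x : ι → ℝ => x ⬝ᵥ P *ᵥ x) (2 * (P *ᵥ x) k) x (Pi.single k 1) := by
  set e : ι → ℝ := Pi.single k 1
  have h1 : e ⬝ᵥ P *ᵥ x = (P *ᵥ x) k := by simp [e]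
  have h2 : x ⬝ᵥ P *ᵥ e = (P *ᵥ x) k := by
    rw [dotProduct_mulVec, ← mulVec_transpose, hP.eq, dotProduct_comm, h1]
  have h3 : (fun t : ℝ => (x + t • e) ⬝ᵥ P *ᵥ (x + t • e)) =
      fun t => x ⬝ᵥ P *ᵥ x + t * (2 * (P *ᵥ x) k) + t ^ 2 * (e ⬝ᵥ P *ᵥ e) := by
    funext t
    simp only [mulVec_add, mulVec_smul, add_dotProduct, dotProduct_add, smul_dotProduct,
      dotProduct_smul, smul_eq_mul, h1, h2]
    ring
  rw [HasLineDerivAt, h3]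
  simpa using! (((hasDerivAt_id (0 : ℝ)).mul_const (2 * (P *ᵥ x) k)).const_add
    (x ⬝ᵥ P *ᵥ x)).add ((hasDerivAt_pow 2 (0 : ℝ)).mul_const (e ⬝ᵥ P *ᵥ e))

theorem Matrix.exists_norm_sq_le_sum_mulVec_sq {ι : Type*} [Fintype ι] [DecidableEq ι]
    {G : Matrix ι ι ℝ} (hG : G.det ≠ 0) :
    ∃ a > 0, ∀ x : ι → ℝ, a * ‖x‖ ^ 2 ≤ ∑ k, (G *ᵥ x) k ^ 2 := by
  set L : (ι → ℝ) →L[ℝ] (ι → ℝ) := (toLin' G⁻¹).toContinuousLinearMap with hL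
  have hLx (x : ι → ℝ) : L (G *ᵥ x) = x := by
    simp [hL, mulVec_mulVec, nonsing_inv_mul _ hG.isUnit]
  refine ⟨1 / (‖L‖ + 1) ^ 2, by positivity, fun x => ?_⟩
  have h1 : ‖x‖ ≤ (‖L‖ + 1) * ‖G *ᵥ x‖ := by
    calc ‖x‖ = ‖L (G *ᵥ x)‖ := by rw [hLx]
      _ ≤ ‖L‖ * ‖G *ᵥ x‖ := L.le_opNorm _
      _ ≤ _ := by gcongr; linarith
  have h2 : ‖G *ᵥ x‖ ^ 2 ≤ ∑ k, (G *ᵥ x) k ^ 2 := by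
    refine (Real.le_sqrt (norm_nonneg _) (Finset.sum_nonneg fun _ _ => sq_nonneg _)).1 <|
      (pi_norm_le_iff_of_nonneg (Real.sqrt_nonneg _)).2
      fun k => Real.abs_le_sqrt ?_
    exact Finset.single_le_sum (f := fun k => (G *ᵥ x) k ^ 2) (fun _ _ => sq_nonneg _)
      (Finset.mem_univ k)
  calc 1 / (‖L‖ + 1) ^ 2 * ‖x‖ ^ 2
      ≤ 1 / (‖L‖ + 1) ^ 2 * ((‖L‖ + 1) * ‖G *ᵥ x‖) ^ 2 := by gcongr
    _ = ‖G *ᵥ x‖ ^ 2 := by field_simp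
    _ ≤ _ := h2

theorem Matrix.sum_mulVec_sq {ι : Type*} [Fintype ι] (G : Matrix ι ι ℝ) (x : ι → ℝ) :
    ∑ k, (G *ᵥ x) k ^ 2 = x ⬝ᵥ (Gᵀ * G) *ᵥ x := by
  rw [← mulVec_mulVec, dotProduct_mulVec, vecMul_transpose]
  simp [dotProduct, sq]

/-- The normalized complex Gaussian with real quadratic form `‖G x‖ ^ 2` and phase `x ⬝ᵥ Q x`. -/
theorem exists_schwartz_gaussian_s18 {n : ℕ} {G Q : Matrix (Fin n) (Fin n) ℝ} (hG : G.det ≠ 0)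
    (hQ : Q.IsSymm) :
    ∃ v : SchwartzMap (Fin n → ℝ) ℂ,
      (∀ x, ‖v x‖ ^ 2 = (∫ y : Fin n → ℝ, Real.exp (-(2 * Real.pi) * ∑ k, (G *ᵥ y) k ^ 2))⁻¹ *
        Real.exp (-(2 * Real.pi) * ∑ k, (G *ᵥ x) k ^ 2)) ∧
      ∀ k x, Dop k v x =
        (Complex.I * (((Gᵀ * G) *ᵥ x) k : ℝ) - ((Q *ᵥ x) k : ℝ)) * v x := by
  set Z := ∫ y : Fin n → ℝ, Real.exp (-(2 * Real.pi) * ∑ k, (G *ᵥ y) k ^ 2)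
  have hZ : 0 < Z := integral_exp_mulVec_pos (by positivity) hG
  set P := Gᵀ * G with hPdef
  have hP : P.IsSymm := by simp [IsSymm, hPdef]
  let f : (Fin n → ℝ) → ℂ := fun x =>
    -(Real.pi : ℂ) * (((x ⬝ᵥ P *ᵥ x : ℝ) : ℂ) + Complex.I * ((x ⬝ᵥ Q *ᵥ x : ℝ) : ℂ))
  have hre (x) : (f x).re = -Real.pi * ∑ k, (G *ᵥ x) k ^ 2 := by
    rw [sum_mulVec_sq]
    simp [f, hPdef]
  have hf : f.HasTemperateGrowth :=
    .mul (.const _) (.add (Function.HasTemperateGrowth.comp Function.Complex.hasTemperateGrowth_ofReal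
      (hasTemperateGrowth_dotProduct_mulVec P)) (.mul (.const _)
        (Function.HasTemperateGrowth.comp Function.Complex.hasTemperateGrowth_ofReal
          (hasTemperateGrowth_dotProduct_mulVec Q))))
  obtain ⟨a, ha, hax⟩ := exists_norm_sq_le_sum_mulVec_sq hG
  obtain ⟨v₀, hv₀⟩ := SchwartzMap.exists_eq_exp hf (a := Real.pi * a) (by positivity) fun x => by
    rw [hre]
    nlinarith [hax x, Real.pi_pos]
  refine ⟨((√Z)⁻¹ : ℝ) • v₀, fun x => ?_, fun k x => ?_⟩
  · rw [_root_.smul_apply, hv₀, norm_smul, Complex.norm_exp, hre, mul_pow, ← Real.exp_nat_mul,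
      Real.norm_of_nonneg (by positivity), inv_pow, Real.sq_sqrt hZ.le]
    push_cast
    ring_nf
  · have hd : HasLineDerivAt ℝ (((√Z)⁻¹ : ℝ) • v₀ : SchwartzMap (Fin n → ℝ) ℂ)
        (((√Z)⁻¹ : ℝ) • (Complex.exp (f x) * (-(Real.pi : ℂ) *
          (((2 * (P *ᵥ x) k : ℝ) : ℂ) + Complex.I * ((2 * (Q *ᵥ x) k : ℝ) : ℂ)))))
        x (Pi.single k 1) := by
      have h1 := HasDerivAt.ofReal_comp (hasLineDerivAt_dotProduct_mulVec hP x k)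
      have h2 := HasDerivAt.ofReal_comp (hasLineDerivAt_dotProduct_mulVec hQ x k)
      have h3 := (((h1.add (h2.const_mul Complex.I)).const_mul (-(Real.pi : ℂ))).cexp).const_smul
        ((√Z)⁻¹ : ℝ)
      simp only [Pi.add_apply, zero_smul, add_zero] at h3
      simpa only [HasLineDerivAt, _root_.smul_apply, hv₀] using! h3
    have hfd := (((√Z)⁻¹ : ℝ) • v₀).differentiableAt (x := x)
    rw [Dop, ← hfd.lineDeriv_eq_fderiv, hd.lineDeriv, _root_.smul_apply, hv₀]
    have hpi : (Real.pi : ℂ) ≠ 0 := by exact_mod_cast Real.pi_ne_zero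
    simp only [Complex.real_smul, Complex.ofReal_mul, Complex.ofReal_ofNat]
    field_simp
    ring_nf
    simp only [Complex.I_sq]
    ring

/-- The energy of a complex Gaussian. -/
theorem exists_schwartz_energy_eq {n : ℕ} (C Ω : Matrix (Fin n) (Fin n) ℝ)
    {G Q : Matrix (Fin n) (Fin n) ℝ} (hG : G.det ≠ 0) (hQ : Q.IsSymm) :
    ∃ v : SchwartzMap (Fin n → ℝ) ℂ, (∫ x, ‖v x‖ ^ 2) = 1 ∧
      (∫ x : Fin n → ℝ, (∑ i, (Ω.mulVec x i) ^ 2) * ‖v x‖ ^ 2) +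
          ∑ j, ∫ x : Fin n → ℝ,
            ‖((x j : ℝ) : ℂ) * v x + ∑ k, ((C j k : ℝ) : ℂ) * Dop k (⇑v) x‖ ^ 2 =
      1 / (4 * Real.pi) * (trace ((Ω * G⁻¹) * (Ω * G⁻¹)ᵀ) +
        trace (((1 - C * Q) * G⁻¹) * ((1 - C * Q) * G⁻¹)ᵀ) + trace ((C * Gᵀ) * (C * Gᵀ)ᵀ)) := by
  obtain ⟨v, hv, hD⟩ := exists_schwartz_gaussian_s18 hG hQ
  set Z := ∫ y : Fin n → ℝ, Real.exp (-(2 * Real.pi) * ∑ k, (G *ᵥ y) k ^ 2) with hZdef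
  have hb : 0 < 2 * Real.pi := by positivity
  have hZ : 0 < Z := integral_exp_mulVec_pos hb hG
  have hint (M : Matrix (Fin n) (Fin n) ℝ) (i : Fin n) :
      Integrable fun x => (M *ᵥ x) i ^ 2 * ‖v x‖ ^ 2 := by
    simp_rw [hv, mul_left_comm _ Z⁻¹]
    exact (integrable_dotProduct_sq_mul_exp_mulVec hb hG (M.row i)).const_mul _
  have hI (M : Matrix (Fin n) (Fin n) ℝ) (i : Fin n) :
      ∫ x, (M *ᵥ x) i ^ 2 * ‖v x‖ ^ 2 =
        1 / (4 * Real.pi) * ((M * G⁻¹) * (M * G⁻¹)ᵀ) i i := by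
    have h1 := integral_dotProduct_sq_mul_exp_mulVec hb hG (M.row i)
    have h2 : (M.row i ᵥ* G⁻¹) ⬝ᵥ (M.row i ᵥ* G⁻¹) = ((M * G⁻¹) * (M * G⁻¹)ᵀ) i i := rfl
    have h3 (x : Fin n → ℝ) : M.row i ⬝ᵥ x = (M *ᵥ x) i := rfl
    simp_rw [h2, h3, ← hZdef] at h1
    simp_rw [hv, mul_left_comm _ Z⁻¹]
    rw [integral_const_mul, h1]
    field_simp
    ring
  have hterm (j : Fin n) (x : Fin n → ℝ) :
      ‖((x j : ℝ) : ℂ) * v x + ∑ k, ((C j k : ℝ) : ℂ) * Dop k (⇑v) x‖ ^ 2 =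
        ((1 - C * Q) *ᵥ x) j ^ 2 * ‖v x‖ ^ 2 + ((C * (Gᵀ * G)) *ᵥ x) j ^ 2 * ‖v x‖ ^ 2 := by
    have h1 : ((1 - C * Q) *ᵥ x) j = x j - ∑ k, C j k * (Q *ᵥ x) k := by
      rw [sub_mulVec, one_mulVec, ← mulVec_mulVec]
      rfl
    have h2 : ((C * (Gᵀ * G)) *ᵥ x) j = ∑ k, C j k * ((Gᵀ * G) *ᵥ x) k := by
      rw [← mulVec_mulVec]
      rfl
    have h3 : ((x j : ℝ) : ℂ) * v x + ∑ k, ((C j k : ℝ) : ℂ) * Dop k (⇑v) x =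
        (((((1 - C * Q) *ᵥ x) j : ℝ) : ℂ) +
          ((((C * (Gᵀ * G)) *ᵥ x) j : ℝ) : ℂ) * Complex.I) * v x := by
      have e (k : Fin n) : ((C j k : ℝ) : ℂ) * Dop k (⇑v) x =
          (C j k : ℂ) * ((((Gᵀ * G) *ᵥ x) k : ℝ) : ℂ) * (Complex.I * v x) -
            (C j k : ℂ) * (((Q *ᵥ x) k : ℝ) : ℂ) * v x := by rw [hD]; ring
      rw [h1, h2]
      push_cast
      simp_rw [e]
      rw [Finset.sum_sub_distrib, ← Finset.sum_mul, ← Finset.sum_mul]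
      ring
    rw [h3, norm_mul, mul_pow, ← Complex.normSq_eq_norm_sq, Complex.normSq_add_mul_I]
    ring
  refine ⟨v, ?_, ?_⟩
  · simp_rw [hv]
    rw [integral_const_mul, inv_mul_cancel₀ hZ.ne']
  · have hΩ : ∫ x : Fin n → ℝ, (∑ i, (Ω.mulVec x i) ^ 2) * ‖v x‖ ^ 2 =
        ∑ i, ∫ x, (Ω *ᵥ x) i ^ 2 * ‖v x‖ ^ 2 := by
      simp_rw [Finset.sum_mul]
      exact integral_finsetSum _ fun i _ => hint Ω i
    have hCG : C * (Gᵀ * G) * G⁻¹ = C * Gᵀ := by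
      rw [← Matrix.mul_assoc, mul_nonsing_inv_cancel_right _ _ hG.isUnit]
    simp_rw [hterm]
    rw [hΩ, Finset.sum_congr rfl fun j _ => integral_add (hint _ j) (hint _ j)]
    simp_rw [hI, hCG, Finset.sum_add_distrib, ← Finset.mul_sum]
    simp only [trace, diag_apply]
    ring

/-- A real symmetric matrix has a symmetric Moore–Penrose pseudoinverse commuting with it. -/
theorem Matrix.IsSymm.exists_pseudoinverse {ι : Type*} [Fintype ι] [DecidableEq ι]
    {C : Matrix ι ι ℝ} (hC : C.IsSymm) :
    ∃ B : Matrix ι ι ℝ, B.IsSymm ∧ C * B = B * C ∧ C * B * C = C ∧ B * C * B = B := by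
  have hH : C.IsHermitian := by rwa [IsHermitian, conjTranspose_eq_transpose_of_trivial]
  set U : Matrix ι ι ℝ := (hH.eigenvectorUnitary : Matrix ι ι ℝ)
  have hU : Uᵀ * U = 1 := by
    simpa [star_eq_conjTranspose] using Unitary.coe_star_mul_self hH.eigenvectorUnitary
  set d := hH.eigenvalues
  have hCd : C = U * diagonal d * Uᵀ := by
    have := hH.spectral_theorem
    rw [Unitary.conjStarAlgAut_apply] at this
    simpa [star_eq_conjTranspose] using this
  have hmul (a b : ι → ℝ) : (U * diagonal a * Uᵀ) * (U * diagonal b * Uᵀ) =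
      U * diagonal (a * b) * Uᵀ := by
    calc _ = U * diagonal a * (Uᵀ * U) * diagonal b * Uᵀ := by simp only [Matrix.mul_assoc]
      _ = U * (diagonal a * diagonal b) * Uᵀ := by rw [hU]; simp only [Matrix.mul_assoc, Matrix.one_mul]
      _ = _ := by rw [diagonal_mul_diagonal]; rfl
  refine ⟨U * diagonal d⁻¹ * Uᵀ, ?_, ?_, ?_, ?_⟩
  · simp [IsSymm, Matrix.mul_assoc]
  · rw [hCd, hmul, hmul, mul_comm]
  · rw [hCd, hmul, hmul]
    congr 3
    funext i
    exact mul_inv_mul_cancel (d i)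
  · rw [hCd, hmul, hmul]
    congr 3
    funext i
    simpa using mul_inv_mul_cancel (d i)⁻¹

theorem Matrix.PosSemidef.exists_transpose_mul_self {ι : Type*} [Fintype ι] [DecidableEq ι]
    {T : Matrix ι ι ℝ} (hT : T.PosSemidef) : ∃ V : Matrix ι ι ℝ, T = Vᵀ * V := by
  open scoped MatrixOrder in
  obtain ⟨V, hV⟩ := CStarAlgebra.nonneg_iff_eq_star_mul_self.1 hT.nonneg
  exact ⟨V, by simpa [star_eq_conjTranspose] using hV⟩

/-- Near-minimizers of the Gaussian energy functional, as an algebraic statement. -/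
theorem exists_gaussian_parameters {ι : Type*} [Fintype ι] [DecidableEq ι]
    {C Ω S : Matrix ι ι ℝ} (hC : C.IsSymm) (hΩ : Ω.PosDef) (hS : S.PosSemidef)
    (hSS : S * S = C * (Ω * Ω) * C) :
    ∃ (Q : Matrix ι ι ℝ) (K : ℝ), Q.IsSymm ∧ ∀ t : ℝ, t ≠ 0 → ∃ G : Matrix ι ι ℝ, G.det ≠ 0 ∧
      trace ((Ω * G⁻¹) * (Ω * G⁻¹)ᵀ) + trace (((1 - C * Q) * G⁻¹) * ((1 - C * Q) * G⁻¹)ᵀ) +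
        trace ((C * Gᵀ) * (C * Gᵀ)ᵀ) = 2 * S.trace + t ^ 2 * K := by
  obtain ⟨B, hB, hCB, hCBC, hBCB⟩ := hC.exists_pseudoinverse
  have hΩs : Ωᵀ = Ω := by simpa using hΩ.1.eq
  have hSs : Sᵀ = S := by simpa using hS.1.eq
  have hCs : Cᵀ = C := hC
  have hBs : Bᵀ = B := hB
  have hΩinj (w : ι → ℝ) (hw : Ω *ᵥ w = 0) : w = 0 := by
    refine mulVec_injective_iff_isUnit.2 hΩ.isUnit ?_
    simpa using hw
  set R := 1 - C * B with hR
  have hCR : C * R = 0 := by rw [hR, mul_sub, mul_one, hCB, ← mul_assoc, hCBC, sub_self]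
  have hRC : R * C = 0 := by rw [hR, sub_mul, one_mul, hCBC, sub_self]
  have hBR : B * R = 0 := by rw [hR, mul_sub, mul_one, ← mul_assoc, hBCB, sub_self]
  have hRB : R * B = 0 := by rw [hR, sub_mul, one_mul, hCB, hBCB, sub_self]
  have hRs : Rᵀ = R := by simp [hR, hCs, hBs, hCB]
  have hRR : R * R = R := by
    conv_lhs => rw [hR, sub_mul, one_mul, mul_assoc, hBR, mul_zero, sub_zero]
  have hSR : S * R = 0 := by
    have : (S * R)ᵀ * (S * R) = 0 := by
      rw [transpose_mul, hSs, mul_assoc, ← mul_assoc S S, hSS, mul_assoc, mul_assoc, hCR]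
      simp
    rwa [← conjTranspose_eq_transpose_of_trivial, conjTranspose_mul_self_eq_zero] at this
  have hRS : R * S = 0 := by
    have := congrArg transpose hSR
    simpa [hSs, hRs] using this
  set T := S + R with hT
  have hTpsd : T.PosSemidef := hS.add (by
    have := posSemidef_conjTranspose_mul_self R
    rwa [conjTranspose_eq_transpose_of_trivial, hRs, hRR] at this)
  have hTdet : T.det ≠ 0 := by
    intro h0
    obtain ⟨x, hx0, hx⟩ := exists_mulVec_eq_zero_iff.2 h0
    refine hx0 ?_
    have hRx : R *ᵥ x = 0 := by
      have : R * T = R := by rw [hT, mul_add, hRS, hRR, zero_add]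
      rw [← this, ← mulVec_mulVec, hx, mulVec_zero]
    have hSSx : (S * S) *ᵥ x = 0 := by
      have : S * T = S * S := by rw [hT, mul_add, hSR, add_zero]
      rw [← this, ← mulVec_mulVec, hx, mulVec_zero]
    have hΩC : (Ω * C) *ᵥ x = 0 := by
      have e : S * S = (Ω * C)ᴴ * (Ω * C) := by
        rw [conjTranspose_eq_transpose_of_trivial, transpose_mul, hΩs, hCs, hSS]
        simp only [mul_assoc]
      rwa [e, conjTranspose_mul_self_mulVec_eq_zero] at hSSx
    have hCx : C *ᵥ x = 0 := hΩinj _ (by rwa [mulVec_mulVec])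
    have : (1 : Matrix ι ι ℝ) = B * C + R := by rw [hR, hCB]; abel
    rw [← one_mulVec x, this, add_mulVec, ← mulVec_mulVec, hCx, hRx]
    simp
  have hTu : IsUnit T.det := hTdet.isUnit
  obtain ⟨V, hV⟩ := hTpsd.exists_transpose_mul_self
  have hVdet : V.det ≠ 0 := by
    intro h0
    simp [hV, h0] at hTdet
  have hVV : V⁻¹ * V⁻¹ᵀ = T⁻¹ := by
    rw [hV, Matrix.mul_inv_rev, transpose_nonsing_inv]
  have hTR : T⁻¹ * R = R := by
    have : T * R = R := by rw [hT, add_mul, hSR, hRR, zero_add]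
    conv_lhs => rw [← this, nonsing_inv_mul_cancel_left _ _ hTu]
  have hTSS : T⁻¹ * (S * S) = S := by
    have : T * S = S * S := by rw [hT, add_mul, hRS, add_zero]
    rw [← this, nonsing_inv_mul_cancel_left _ _ hTu]
  have hRT : R * T⁻¹ = R := by
    have : R * T = R := by rw [hT, mul_add, hRS, hRR, zero_add]
    conv_lhs => rw [← this, mul_nonsing_inv_cancel_right _ _ hTu]
  refine ⟨B, trace (Ω * R * Ω) + trace R, hB, fun t ht => ?_⟩
  set N := C + t • R with hN
  set M := B + t⁻¹ • R with hM
  have hNs : Nᵀ = N := by simp [hN, hCs, hRs]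
  have hMs : Mᵀ = M := by simp [hM, hBs, hRs]
  have hNM : N * M = 1 := by
    simp only [hN, hM, add_mul, mul_add, smul_mul_assoc, mul_smul_comm, hCR, hRB, hRR, smul_zero,
      add_zero, zero_add, smul_smul, inv_mul_cancel₀ ht, one_smul]
    rw [hR]; abel
  have hMN : M * N = 1 := mul_eq_one_comm.1 hNM
  have hMdet : M.det ≠ 0 := by
    intro h0
    have := congrArg det hMN
    simp [h0] at this
  have hMinv : M⁻¹ = N := inv_eq_right_inv hMN
  have hinv (A : Matrix ι ι ℝ) : (A * (V * M)⁻¹) * (A * (V * M)⁻¹)ᵀ = A * (N * T⁻¹ * N) * Aᵀ := by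
    rw [Matrix.mul_inv_rev, hMinv, transpose_mul, transpose_mul, hNs, ← hVV]
    simp only [mul_assoc]
  have hNTN : N * T⁻¹ * N = C * T⁻¹ * C + t ^ 2 • R := by
    simp only [hN, add_mul, mul_add, smul_mul_assoc, mul_smul_comm, hRT, mul_assoc, hTR, hCR, hRC,
      hRR, smul_zero, add_zero, zero_add, smul_smul, sq]
  refine ⟨V * M, by simpa using ⟨hVdet, hMdet⟩, ?_⟩
  have e1 : trace (Ω * (C * T⁻¹ * C + t ^ 2 • R) * Ω) = S.trace + t ^ 2 * trace (Ω * R * Ω) := by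
    rw [mul_add, add_mul, trace_add, mul_smul_comm, smul_mul_assoc, trace_smul, smul_eq_mul]
    congr 1
    calc trace (Ω * (C * T⁻¹ * C) * Ω) = trace ((Ω * C) * (T⁻¹ * (C * Ω))) := by
          simp only [mul_assoc]
      _ = trace (T⁻¹ * (S * S)) := by
          rw [trace_mul_comm, hSS]
          simp only [mul_assoc]
      _ = S.trace := by rw [hTSS]
  have e2 : R * (C * T⁻¹ * C + t ^ 2 • R) * R = t ^ 2 • R := by
    rw [mul_add, mul_assoc C, ← mul_assoc R C, hRC]
    simp [hRR]
  have e3 : (C * (V * M)ᵀ) * (C * (V * M)ᵀ)ᵀ = S := by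
    have hCM : C * M = 1 - R := by
      rw [hM, mul_add, mul_smul_comm, hCR, hR, smul_zero, add_zero, sub_sub_cancel]
    have hMC : M * C = 1 - R := by
      rw [hM, add_mul, smul_mul_assoc, hRC, hR, smul_zero, add_zero, sub_sub_cancel, hCB]
    calc _ = C * M * (Vᵀ * V) * (M * C) := by
          simp only [transpose_mul, transpose_transpose, hCs, hMs, mul_assoc]
      _ = (1 - R) * T * (1 - R) := by rw [hCM, hMC, ← hV]
      _ = S := by
          simp [hT, sub_mul, mul_sub, mul_add, hRS, hSR, hRR]
  rw [hinv, hinv, hΩs, hRs, hNTN, e1, e2, e3, trace_smul, smul_eq_mul]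
  ring

/-- The bottom of the spectrum of the Weyl quantization of `‖Ωx‖² + ‖Cξ + x‖²` is at
most `(1/2π)·trace(√(CΩ²C))`, where `√(CΩ²C)` is the positive semidefinite square
root of `CΩ²C` (quantified as any `S ≥ 0` with `S·S = CΩ²C`). -/
theorem inf_harmonic_energy_le {n : ℕ} (hn : 1 ≤ n)
    (C Ω : Matrix (Fin n) (Fin n) ℝ) (hC : C.IsSymm) (hΩ : Ω.PosDef)
    (S : Matrix (Fin n) (Fin n) ℝ) (hS : S.PosSemidef) (hSS : S * S = C * (Ω * Ω) * C) :
    sInf { r : ℝ | ∃ v : SchwartzMap (Fin n → ℝ) ℂ,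
        (∫ x, ‖v x‖ ^ 2) = 1 ∧
        r = (∫ x : Fin n → ℝ, (∑ i, (Ω.mulVec x i) ^ 2) * ‖v x‖ ^ 2) +
          ∑ j, ∫ x : Fin n → ℝ,
            ‖((x j : ℝ) : ℂ) * v x + ∑ k, ((C j k : ℝ) : ℂ) * Dop k (⇑v) x‖ ^ 2 } ≤
      (1 / (2 * Real.pi)) * S.trace := by
  obtain ⟨Q, K, hQ, hG⟩ := exists_gaussian_parameters hC hΩ hS hSS
  have hlim : Filter.Tendsto (fun t : ℝ => 1 / (4 * Real.pi) * (2 * S.trace + t ^ 2 * K))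
      (nhdsWithin 0 {0}ᶜ) (nhds (1 / (2 * Real.pi) * S.trace)) := by
    have h : ContinuousAt (fun t : ℝ => 1 / (4 * Real.pi) * (2 * S.trace + t ^ 2 * K)) 0 := by
      fun_prop
    convert h.tendsto.mono_left nhdsWithin_le_nhds using 2
    field_simp
    ring
  refine ge_of_tendsto hlim ?_
  filter_upwards [self_mem_nhdsWithin] with t ht
  obtain ⟨G, hGdet, hGtr⟩ := hG t ht
  obtain ⟨v, hv, hE⟩ := exists_schwartz_energy_eq C Ω hGdet hQ
  rw [hGtr] at hE
  refine csInf_le ⟨0, ?_⟩ ⟨v, hv, hE.symm⟩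
  rintro r ⟨w, -, rfl⟩
  exact add_nonneg (integral_nonneg fun x => by positivity)
    (Finset.sum_nonneg fun j _ => integral_nonneg fun x => by positivity)

end
end
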